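/- arXiv:1802.04991 — 6 statements merged into one kernel-verified Lean document; each statement's English description precedes it below -/
import Mathlib

section
/- Let ι be a countable type and f : ι → ℝ a nonnegative function such that for every R ∈ ℝ the set {i : f(i) ≤ R} is finite. Set h := limsup_{R→∞} (1/R)·log #{i : f(i) ≤ R}, the limsup taken in [0,∞]. If h < ∞, then for every real s > h the family (e^{−s·f(i)})_{i∈ι} is summable. -/
open Filter in
/-- If the counting function of `f` is eventually at most `exp (t * R)`, then
`∑ i, exp (-s * f i)` converges for every `s > t`, where `0 ≤ s`. -/
lemma summable_exp_neg_mul_of_ncard_le_exp {ι : Type*} {f : ι → ℝ} {s t : ℝ}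
    (hf0 : ∀ i, 0 ≤ f i) (hfin : ∀ R : ℝ, {i : ι | f i ≤ R}.Finite)
    (hs : 0 ≤ s) (hts : t < s)
    (hcount : ∀ᶠ R : ℝ in atTop, ({i : ι | f i ≤ R}.ncard : ℝ) ≤ Real.exp (t * R)) :
    Summable (fun i : ι => Real.exp (-s * f i)) := by
  let F : ι → ℕ := fun i => ⌊f i⌋₊
  have hFle : ∀ n : ℕ, {i | F i = n} ⊆ {i | f i ≤ (n : ℝ) + 1} := by
    rintro n i rfl
    exact (Nat.lt_floor_add_one (f i)).le
  have hfib : ∀ n : ℕ, Finite {i // F i = n} := fun n => ((hfin _).subset (hFle n)).to_subtype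
  refine (Equiv.sigmaFiberEquiv F).summable_iff.1 <|
    (summable_sigma_of_nonneg fun _ => Real.exp_nonneg _).2 ⟨fun n => Summable.of_finite, ?_⟩
  have hgeom : Summable fun n : ℕ => Real.exp t * Real.exp (n * (t - s)) :=
    (Real.summable_exp_nat_mul_iff.2 (sub_neg.2 hts)).mul_left _
  refine hgeom.of_norm_bounded_eventually_nat ?_
  have hshift : Tendsto (fun n : ℕ => (n : ℝ) + 1) atTop atTop :=
    tendsto_atTop_add_const_right _ _ tendsto_natCast_atTop_atTop
  filter_upwards [hshift.eventually hcount] with n hn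
  have : Fintype {i // F i = n} := Fintype.ofFinite _
  rw [Real.norm_of_nonneg (tsum_nonneg fun _ => Real.exp_nonneg _), tsum_fintype]
  have hterm : ∀ x : {i // F i = n}, Real.exp (-s * f x) ≤ Real.exp (-s * n) := by
    rintro ⟨i, rfl⟩
    exact Real.exp_le_exp.2 (mul_le_mul_of_nonpos_left (Nat.floor_le (hf0 i)) (neg_nonpos.2 hs))
  have hcard : (Fintype.card {i // F i = n} : ℝ) ≤ Real.exp (t * (n + 1)) := by
    refine le_trans ?_ hn
    rw [← Nat.card_eq_fintype_card]
    exact_mod_cast Set.ncard_le_ncard (hFle n) (hfin _)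
  calc ∑ x : {i // F i = n}, Real.exp (-s * f x)
      ≤ Fintype.card {i // F i = n} * Real.exp (-s * n) := by
        simpa using Finset.sum_le_card_nsmul Finset.univ _ _ fun x _ => hterm x
    _ ≤ Real.exp (t * (n + 1)) * Real.exp (-s * n) := by gcongr
    _ = Real.exp t * Real.exp (n * (t - s)) := by
        rw [← Real.exp_add, ← Real.exp_add]
        ring_nf

/-- Convergence half of the identification of the critical exponent of a
Poincaré-type series `∑ i, exp (-s * f i)` with the exponential growth rate
of the counting function `R ↦ #{i | f i ≤ R}`: if the growth rate `h`
(a limsup taken in `[0,∞]`) is finite, then for every real `s > h` the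
family `(exp (-s * f i))_i` is summable. -/
theorem poincare_series_summable_of_growth_lt
    {ι : Type*} [Countable ι] (f : ι → ℝ)
    (hf0 : ∀ i, 0 ≤ f i)
    (hfin : ∀ R : ℝ, {i : ι | f i ≤ R}.Finite)
    (h : ENNReal)
    (hh : h = Filter.limsup
      (fun R : ℝ => ENNReal.ofReal ((1 / R) * Real.log (({i : ι | f i ≤ R}).ncard)))
      Filter.atTop)
    (htop : h ≠ ⊤)
    (s : ℝ) (hs : h < ENNReal.ofReal s) :
    Summable (fun i : ι => Real.exp (-s * f i)) := by
  obtain ⟨t, ht0, hht, hts⟩ := ENNReal.lt_iff_exists_real_btwn.1 hs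
  have hts' : t < s := (ENNReal.ofReal_lt_ofReal_iff_of_nonneg ht0).1 hts
  refine summable_exp_neg_mul_of_ncard_le_exp hf0 hfin (ht0.trans hts'.le) hts' ?_
  rw [hh] at hht
  filter_upwards [Filter.eventually_lt_of_limsup_lt hht, Filter.eventually_gt_atTop 0] with R hR hR0
  have hlog := (ENNReal.ofReal_lt_ofReal_iff'.1 hR).1
  rw [one_div, inv_mul_lt_iff₀ hR0, mul_comm] at hlog
  exact (Real.le_exp_log _).trans (Real.exp_le_exp.2 hlog.le)
end

section
/- Let ι be a countable type and f : ι → ℝ a nonnegative function such that for every R ∈ ℝ the set {i : f(i) ≤ R} is finite. If s is a real number with 0 ≤ s < limsup_{R→∞} (1/R)·log #{i : f(i) ≤ R} (the limsup taken in [0,∞]), then the family (e^{−s·f(i)})_{i∈ι} is not summable. -/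
open Filter Topology

/-- If `∑ i, exp (-s * f i)` converges with `0 ≤ s`, then the counting function of `f` is at most
`exp (s * R)` times the sum of the series. -/
theorem ncard_le_tsum_mul_exp {ι : Type*} {f : ι → ℝ} {s R : ℝ} (hs0 : 0 ≤ s)
    (hfin : {i : ι | f i ≤ R}.Finite) (hsum : Summable fun i ↦ Real.exp (-s * f i)) :
    ({i : ι | f i ≤ R}.ncard : ℝ) ≤ (∑' i, Real.exp (-s * f i)) * Real.exp (s * R) := by
  have h : (hfin.toFinset.card : ℝ) * Real.exp (-(s * R)) ≤ ∑' i, Real.exp (-s * f i) := by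
    rw [← nsmul_eq_mul]
    refine (Finset.card_nsmul_le_sum _ _ _ fun i hi ↦ ?_).trans
      (hsum.sum_le_tsum hfin.toFinset fun i _ ↦ (Real.exp_pos _).le)
    rw [neg_mul, Real.exp_le_exp, neg_le_neg_iff]
    exact mul_le_mul_of_nonneg_left (by simpa using hi) hs0
  rwa [Set.ncard_eq_toFinset_card _ hfin, ← div_le_iff₀ (Real.exp_pos _), div_eq_mul_inv,
    ← Real.exp_neg]

/-- Divergence half of the identification of the critical exponent of a
Poincaré-type series `∑ i, exp (-s * f i)` with the exponential growth rate
of the counting function `R ↦ #{i | f i ≤ R}`: if `0 ≤ s` is a real number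
strictly below the growth rate (a limsup taken in `[0,∞]`), then the family
`(exp (-s * f i))_i` is not summable. -/
theorem poincare_series_not_summable_of_lt_growth
    {ι : Type*} [Countable ι] (f : ι → ℝ)
    (hf0 : ∀ i, 0 ≤ f i)
    (hfin : ∀ R : ℝ, {i : ι | f i ≤ R}.Finite)
    (s : ℝ) (hs0 : 0 ≤ s)
    (hs : ENNReal.ofReal s < Filter.limsup
      (fun R : ℝ => ENNReal.ofReal ((1 / R) * Real.log (({i : ι | f i ≤ R}).ncard)))
      Filter.atTop) :
    ¬ Summable (fun i : ι => Real.exp (-s * f i)) := by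
  intro hsum
  set S := max (∑' i, Real.exp (-s * f i)) 1
  have hS1 : 1 ≤ S := le_max_right _ _
  have hlog (R : ℝ) (hR : 0 < R) :
      Real.log ({i : ι | f i ≤ R}.ncard) ≤ Real.log S + s * R := by
    rcases Nat.eq_zero_or_pos {i : ι | f i ≤ R}.ncard with h | h
    · rw [h, Nat.cast_zero, Real.log_zero]
      exact add_nonneg (Real.log_nonneg hS1) (mul_nonneg hs0 hR.le)
    · rw [← Real.log_exp (s * R), ← Real.log_mul (by positivity) (Real.exp_ne_zero _)]
      refine Real.log_le_log (by exact_mod_cast h)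
        ((ncard_le_tsum_mul_exp hs0 (hfin R) hsum).trans ?_)
      gcongr
      exact le_max_left _ _
  have hlim : Tendsto (fun R : ℝ ↦ ENNReal.ofReal (Real.log S / R + s)) atTop
      (𝓝 (ENNReal.ofReal s)) := by
    refine ENNReal.tendsto_ofReal ?_
    simpa using (tendsto_const_nhds.div_atTop tendsto_id).add_const s
  refine hs.not_ge ((limsup_le_limsup ?_).trans_eq hlim.limsup_eq)
  filter_upwards [eventually_gt_atTop 0] with R hR
  refine ENNReal.ofReal_le_ofReal ?_
  rw [one_div_mul_eq_div, div_le_iff₀ hR, add_mul, div_mul_cancel₀ _ hR.ne']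
  exact hlog R hR
end

section
/- Let ι be a countable type and f : ι → ℝ a nonnegative function whose sublevel sets {i : f(i) ≤ R} are finite for every R ∈ ℝ. Let h : [0,∞) → (0,∞) be a nondecreasing function of slow growth, meaning: for every η > 0 there exist C_η > 0 and r_η ≥ 0 such that h(t + r) ≤ C_η·e^{η t}·h(r) for all r ≥ r_η and all t ≥ 0. Let δ := inf{s ≥ 0 : ∑_{i∈ι} e^{−s·f(i)} < ∞} ∈ [0,∞]. Then the weighted family (h(f(i))·e^{−s·f(i)})_{i∈ι} is summable for every real s > δ and is not summable for every real s with 0 ≤ s < δ; in other words, the weighted series ∑_i h(f(i)) e^{−s f(i)} has the same critical exponent δ as the unweighted series. -/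
/-- A nondecreasing positive function of slow growth at rate `η` beyond `r₀` is bounded on `[0,∞)`
by a multiple of `exp (η * x)`. -/
theorem slow_growth_le_const_mul_exp {h : ℝ → ℝ} {η C r₀ : ℝ} (hη : 0 ≤ η) (hC : 0 ≤ C)
    (hr₀ : 0 ≤ r₀) (hpos : 0 < h r₀) (hmono : ∀ t t' : ℝ, 0 ≤ t → t ≤ t' → h t ≤ h t')
    (hslow : ∀ t : ℝ, 0 ≤ t → h (t + r₀) ≤ C * Real.exp (η * t) * h r₀) {x : ℝ} (hx : 0 ≤ x) :
    h x ≤ (C + 1) * h r₀ * Real.exp (η * x) := by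
  have hηx : 0 ≤ η * x := mul_nonneg hη hx
  have hexp : h r₀ ≤ h r₀ * Real.exp (η * x) :=
    le_mul_of_one_le_right hpos.le (Real.one_le_exp hηx)
  have hCexp : 0 ≤ C * h r₀ * Real.exp (η * x) := by positivity
  have hHexp : 0 ≤ h r₀ * Real.exp (η * x) := by positivity
  rcases le_total r₀ x with hrx | hxr
  · calc
      h x = h ((x - r₀) + r₀) := by rw [sub_add_cancel]
      _ ≤ C * Real.exp (η * (x - r₀)) * h r₀ := hslow _ (sub_nonneg.2 hrx)
      _ ≤ C * Real.exp (η * x) * h r₀ := by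
        gcongr
        exact sub_le_self x hr₀
      _ ≤ (C + 1) * h r₀ * Real.exp (η * x) := by linarith
  · linarith [hmono x r₀ hx hxr]


/-- Patterson's trick: a nondecreasing multiplier `h : [0,∞) → (0,∞)` of slow
growth (for every `η > 0` there are `C_η > 0` and `r_η ≥ 0` with
`h (t + r) ≤ C_η e^{η t} h r` for all `r ≥ r_η`, `t ≥ 0`) does not change the
critical exponent `δ` of a Poincaré-type series `∑ i, exp (-s * f i)`: the
weighted family `(h (f i) · exp (-s * f i))_i` is summable for every real
`s > δ` and not summable for every real `0 ≤ s < δ`. -/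
theorem patterson_multiplier_same_critical_exponent
    {ι : Type*} [Countable ι] (f : ι → ℝ)
    (hf0 : ∀ i, 0 ≤ f i)
    (hfin : ∀ R : ℝ, {i : ι | f i ≤ R}.Finite)
    (h : ℝ → ℝ)
    (hpos : ∀ t : ℝ, 0 ≤ t → 0 < h t)
    (hmono : ∀ t t' : ℝ, 0 ≤ t → t ≤ t' → h t ≤ h t')
    (hslow : ∀ η : ℝ, 0 < η → ∃ C : ℝ, 0 < C ∧ ∃ r₀ : ℝ, 0 ≤ r₀ ∧
      ∀ r : ℝ, r₀ ≤ r → ∀ t : ℝ, 0 ≤ t → h (t + r) ≤ C * Real.exp (η * t) * h r)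
    (δ : ENNReal)
    (hδ : δ = sInf (ENNReal.ofReal ''
      {s : ℝ | 0 ≤ s ∧ Summable (fun i : ι => Real.exp (-s * f i))})) :
    (∀ s : ℝ, δ < ENNReal.ofReal s →
      Summable (fun i : ι => h (f i) * Real.exp (-s * f i))) ∧
    (∀ s : ℝ, 0 ≤ s → ENNReal.ofReal s < δ →
      ¬ Summable (fun i : ι => h (f i) * Real.exp (-s * f i))) := by
  constructor
  · intro s hs
    rw [hδ, sInf_lt_iff] at hs
    obtain ⟨_, ⟨s', ⟨hs'0, hsum⟩, rfl⟩, hlt⟩ := hs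
    have hss : s' < s := (ENNReal.ofReal_lt_ofReal_iff_of_nonneg hs'0).1 hlt
    have hη : 0 < s - s' := sub_pos.2 hss
    obtain ⟨C, hC, r₀, hr₀, hgrow⟩ := hslow (s - s') hη
    refine (hsum.mul_left ((C + 1) * h r₀)).of_nonneg_of_le
      (fun i => mul_nonneg (hpos _ (hf0 i)).le (Real.exp_pos _).le) fun i => ?_
    calc
      h (f i) * Real.exp (-s * f i)
          ≤ (C + 1) * h r₀ * Real.exp ((s - s') * f i) * Real.exp (-s * f i) := by
        gcongr
        exact slow_growth_le_const_mul_exp hη.le hC.le hr₀ (hpos r₀ hr₀) hmono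
          (hgrow r₀ le_rfl) (hf0 i)
      _ = (C + 1) * h r₀ * Real.exp (-s' * f i) := by
        rw [mul_assoc, ← Real.exp_add]
        ring_nf
  · intro s hs0 hs hsum
    refine hs.not_ge (hδ ▸ sInf_le ⟨s, ⟨hs0, ?_⟩, rfl⟩)
    rw [← summable_mul_left_iff (hpos 0 le_rfl).ne']
    refine hsum.of_nonneg_of_le
      (fun i => mul_nonneg (hpos 0 le_rfl).le (Real.exp_pos _).le) fun i => ?_
    gcongr
    exact hmono 0 (f i) le_rfl (hf0 i)
end

section
/- Let E be a real inner product space. For all x, y, z ∈ E, the distance from z to the segment [x,y] = {(1−t)·x + t·y : t ∈ [0,1]} satisfies infDist(z, [x,y]) ≤ (1/2)·√((‖x−z‖ + ‖z−y‖)² − ‖x−y‖²). -/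
/-- Stewart's theorem in a real inner product space. -/
theorem norm_sub_convex_combination_sq
    {E : Type*} [NormedAddCommGroup E] [InnerProductSpace ℝ E]
    (x y z : E) (t : ℝ) :
    ‖z - ((1 - t) • x + t • y)‖ ^ 2 =
      (1 - t) * ‖x - z‖ ^ 2 + t * ‖z - y‖ ^ 2 - t * (1 - t) * ‖x - y‖ ^ 2 := by
  have hw : z - ((1 - t) • x + t • y) = t • (z - y) - (1 - t) • (x - z) := by
    module
  have hxy : x - y = (z - y) + (x - z) := by abel
  rw [hw, hxy, norm_sub_sq_real, norm_add_sq_real, norm_smul, norm_smul, mul_pow, mul_pow,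
    Real.norm_eq_abs, Real.norm_eq_abs, sq_abs, sq_abs, real_inner_smul_left,
    real_inner_smul_right]
  ring

/-- Euclidean (CAT(0)-comparison) estimate: in a real inner product space, the
distance from a point `z` to the segment `[x, y]` is at most
`(1/2) · √((‖x - z‖ + ‖z - y‖)² - ‖x - y‖²)`. -/
theorem infDist_segment_le_comparison
    {E : Type*} [NormedAddCommGroup E] [InnerProductSpace ℝ E]
    (x y z : E) :
    Metric.infDist z (segment ℝ x y) ≤
      (1 / 2) * Real.sqrt ((‖x - z‖ + ‖z - y‖) ^ 2 - ‖x - y‖ ^ 2) := by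
  have ha := norm_nonneg (x - z)
  have hb := norm_nonneg (z - y)
  have hL0 := norm_nonneg (x - y)
  have hL : ‖x - y‖ ≤ ‖x - z‖ + ‖z - y‖ := norm_sub_le_norm_sub_add_norm_sub x z y
  -- the foot of the bisector at `z` divides the segment in the ratio of the adjacent sides
  set t : ℝ := ‖x - z‖ / (‖x - z‖ + ‖z - y‖) with ht
  have ht0 : 0 ≤ t := by positivity
  have ht1 : t ≤ 1 := div_le_one_of_le₀ (by linarith) (by positivity)
  have hmem : (1 - t) • x + t • y ∈ segment ℝ x y :=
    ⟨1 - t, t, by linarith, ht0, by ring, rfl⟩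
  refine (Metric.infDist_le_dist_of_mem hmem).trans ?_
  have hstew := norm_sub_convex_combination_sq x y z t
  clear_value t
  rw [dist_eq_norm]
  generalize ‖z - ((1 - t) • x + t • y)‖ = d at *
  generalize ‖x - z‖ = a at *
  generalize ‖z - y‖ = b at *
  generalize ‖x - y‖ = L at *
  have hta : t * (a + b) = a := by
    rcases eq_or_ne (a + b) 0 with h | h
    · rw [h, mul_zero]
      linarith
    · rw [ht, div_mul_cancel₀ a h]
  have hfac : d ^ 2 = t * (1 - t) * ((a + b) ^ 2 - L ^ 2) := by
    linear_combination hstew + (t * (a + b) - a) * hta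
  have hnn : 0 ≤ (a + b) ^ 2 - L ^ 2 := sub_nonneg.mpr (pow_le_pow_left₀ hL0 hL 2)
  have hd : (2 * d) ^ 2 ≤ (a + b) ^ 2 - L ^ 2 := by
    nlinarith [mul_nonneg (sq_nonneg (1 - 2 * t)) hnn]
  linarith [Real.le_sqrt_of_sq_le hd]
end

section
/- In the hyperbolic upper half-plane ℍ = {w ∈ ℂ : Im w > 0} equipped with its standard hyperbolic distance, for all x, y ∈ ℍ one has lim_{s→+∞} (dist(x, i·s) − dist(y, i·s)) = log(Im y) − log(Im x), where i·s denotes the point of ℍ with real part 0 and imaginary part s. -/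
open UpperHalfPlane

lemma norm_sub_ofReal_mul_eq {s : ℝ} (hs : 0 < s) (z w : ℂ) :
    ‖z - s * w‖ = s * ‖(s : ℂ)⁻¹ * z - w‖ := by
  have hs' : (s : ℂ) ≠ 0 := by exact_mod_cast hs.ne'
  calc ‖z - s * w‖ = ‖(s : ℂ) * ((s : ℂ)⁻¹ * z - w)‖ := by
        rw [mul_sub, mul_inv_cancel_left₀ hs']
    _ = s * ‖(s : ℂ)⁻¹ * z - w‖ := by
        rw [norm_mul, Complex.norm_of_nonneg hs.le]

lemma tendsto_norm_inv_mul_sub_atTop (z w : ℂ) :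
    Filter.Tendsto (fun s : ℝ => ‖(s : ℂ)⁻¹ * z - w‖) Filter.atTop (nhds ‖w‖) := by
  have h : Filter.Tendsto (fun s : ℝ => ((s⁻¹ : ℝ) : ℂ)) Filter.atTop (nhds ((0 : ℝ) : ℂ)) :=
    (Complex.continuous_ofReal.tendsto 0).comp tendsto_inv_atTop_zero
  simpa using ((h.mul_const z).sub_const w).norm

lemma UpperHalfPlane.dist_I_mul_sub_log (z : UpperHalfPlane) {s : ℝ} (hs : 0 < s)
    (h : 0 < (Complex.I * (s : ℂ)).im) :
    dist z (UpperHalfPlane.mk (Complex.I * (s : ℂ)) h) - Real.log s =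
      2 * Real.log ((‖(s : ℂ)⁻¹ * z - Complex.I‖ + ‖(s : ℂ)⁻¹ * z - -Complex.I‖) / 2) -
        Real.log z.im := by
  set w := UpperHalfPlane.mk (Complex.I * (s : ℂ)) h with hw
  have him : w.im = s := by simp [hw, UpperHalfPlane.im]
  have hcoe : (w : ℂ) = s * Complex.I := mul_comm _ _
  have hconj : (starRingEnd ℂ) (w : ℂ) = s * -Complex.I := by simp [hcoe]
  have hz := z.im_pos
  have key := UpperHalfPlane.exp_half_dist z w
  rw [hconj, hcoe, him, dist_eq_norm, dist_eq_norm, norm_sub_ofReal_mul_eq hs,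
    norm_sub_ofReal_mul_eq hs, ← mul_add] at key
  set A := ‖(s : ℂ)⁻¹ * z - Complex.I‖ + ‖(s : ℂ)⁻¹ * z - -Complex.I‖
  have hA : A ≠ 0 := by
    intro hA
    rw [hA] at key
    simp [Real.exp_ne_zero] at key
  have hlog := congrArg Real.log key
  rw [Real.log_exp, Real.log_div (by positivity) (by positivity), Real.log_mul hs.ne' hA,
    Real.log_mul two_ne_zero (by positivity), Real.log_sqrt (by positivity),
    Real.log_mul hz.ne' hs.ne'] at hlog
  rw [Real.log_div hA two_ne_zero]
  linarith

lemma UpperHalfPlane.tendsto_dist_I_mul_sub_log (z : UpperHalfPlane) :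
    Filter.Tendsto
      (fun s : {s : ℝ // 0 < s} =>
        dist z (UpperHalfPlane.mk (Complex.I * (s : ℝ)) (by simpa using s.2)) - Real.log s)
      Filter.atTop (nhds (-Real.log z.im)) := by
  have hs : Filter.Tendsto (fun s : {s : ℝ // 0 < s} => (s : ℝ)) Filter.atTop Filter.atTop :=
    Filter.tendsto_atTop.2 fun b =>
      (Filter.eventually_ge_atTop (⟨max b 1, by positivity⟩ : {s : ℝ // 0 < s})).mono
        fun s h => (le_max_left b 1).trans h
  have hA := (((tendsto_norm_inv_mul_sub_atTop z Complex.I).add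
    (tendsto_norm_inv_mul_sub_atTop z (-Complex.I))).div_const 2).comp hs
  have hlim := ((hA.log (by simp)).const_mul 2).sub_const (Real.log z.im)
  simp only [norm_neg, Complex.norm_I, add_self_div_two, Real.log_one, mul_zero, zero_sub] at hlim
  exact hlim.congr fun s => (z.dist_I_mul_sub_log s.2 _).symm

/-- The Busemann function of the hyperbolic upper half-plane at the boundary
point `∞`: for `x, y ∈ ℍ`,
`lim_{s → +∞} (dist x (i·s) - dist y (i·s)) = log (Im y) - log (Im x)`,
the limit being taken along points `i·s` of the imaginary axis. -/
theorem upperHalfPlane_busemann_at_infinity (x y : UpperHalfPlane) :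
    Filter.Tendsto
      (fun s : {s : ℝ // 0 < s} =>
        dist x (UpperHalfPlane.mk (Complex.I * (s : ℝ))
            (by simpa using s.2)) -
          dist y (UpperHalfPlane.mk (Complex.I * (s : ℝ))
            (by simpa using s.2)))
      Filter.atTop
      (nhds (Real.log y.im - Real.log x.im)) := by
  have h := x.tendsto_dist_I_mul_sub_log.sub y.tendsto_dist_I_mul_sub_log
  simp only [sub_sub_sub_cancel_right, neg_sub_neg] at h
  exact h
end

section
/- In the hyperbolic upper half-plane ℍ = {w ∈ ℂ : Im w > 0} with its standard hyperbolic distance, let x, y ∈ ℍ and let t be a real number with t ≥ dist(x,y). Let x_t ∈ ℍ be the point with Re x_t = Re x and Im x_t = e^t·Im x (so that dist(x, x_t) = t, x_t being the point at distance t from x on the geodesic ray from x to the boundary point ∞). Then |log(Im y / Im x) − (t − dist(y, x_t))| ≤ (e^{dist(x,y)} − 1)·e^{−t}. -/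
open UpperHalfPlane

/-- The algebraic inequality comparing `cosh` of the distance from `y` to the point at height `T`
with its claimed upper bound; here `A` is `e^{dist x y}` and `v` is `Im y / Im x`. -/
lemma mul_add_inv_sub_one_le {A T v : ℝ} (hA : 1 ≤ A) (hT : A ≤ T) :
    v * (A + A⁻¹) - 1 ≤ (A - 1) * T + v ^ 2 * (T / (T + (A - 1))) := by
  have hA0 : 0 < A := by linarith
  have hB : 0 < 2 * A - 1 := by linarith
  have hfrac : A / (2 * A - 1) ≤ T / (T + (A - 1)) := by
    rw [div_le_div_iff₀ hB (by linarith)]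
    nlinarith [mul_nonneg (sub_nonneg.2 hA) (sub_nonneg.2 hT)]
  have hlin : (A - 1) * A ≤ (A - 1) * T := mul_le_mul_of_nonneg_left hT (by linarith)
  have hquad : v ^ 2 * (A / (2 * A - 1)) ≤ v ^ 2 * (T / (T + (A - 1))) :=
    mul_le_mul_of_nonneg_left hfrac (sq_nonneg v)
  have hdisc : 0 ≤ 2 * A ^ 5 - 3 * A ^ 4 + 2 * A ^ 2 - 2 * A + 1 := by
    obtain ⟨e, he, rfl⟩ : ∃ e : ℝ, 0 ≤ e ∧ A = 1 + e := ⟨A - 1, by linarith, by ring⟩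
    ring_nf
    positivity
  have hid : (A - 1) * A + v ^ 2 * (A / (2 * A - 1)) - (v * (A + A⁻¹) - 1) =
      ((2 * A ^ 2 * v - (A ^ 2 + 1) * (2 * A - 1)) ^ 2 +
        (2 * A - 1) * (2 * A ^ 5 - 3 * A ^ 4 + 2 * A ^ 2 - 2 * A + 1)) /
        (4 * A ^ 3 * (2 * A - 1)) := by
    obtain ⟨B, hBA⟩ : ∃ B, B = 2 * A - 1 := ⟨_, rfl⟩
    rw [← hBA] at hB ⊢
    field_simp
    subst hBA
    ring
  have hnonneg : 0 ≤ (A - 1) * A + v ^ 2 * (A / (2 * A - 1)) - (v * (A + A⁻¹) - 1) := by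
    rw [hid]
    positivity
  linarith

/-- The distance from `y` to a point vertically above `x`, in terms of `dist x y`. -/
lemma cosh_dist_of_re_eq_of_im_eq_mul {x y z : UpperHalfPlane} {T : ℝ} (hT : 0 < T)
    (hre : z.re = x.re) (him : z.im = T * x.im) :
    Real.cosh (dist y z) =
      (y.im / x.im * (2 * Real.cosh (dist x y)) - 1 + T ^ 2) / (2 * (y.im / x.im) * T) := by
  have hx := x.im_pos
  have hy := y.im_pos
  rw [UpperHalfPlane.cosh_dist', UpperHalfPlane.cosh_dist', hre, him]
  field_simp
  ring

/-- Quantitative convergence to the Busemann function of the hyperbolic upper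
half-plane at the boundary point `∞` (instance of Lemma 5.1(1)): if
`xt` is the point at distance `t ≥ dist x y` from `x` on the geodesic ray from
`x` to `∞` (i.e. `Re xt = Re x` and `Im xt = e^t · Im x`), then
`|log (Im y / Im x) - (t - dist y xt)| ≤ (e^{dist x y} - 1) · e^{-t}`. -/
theorem upperHalfPlane_busemann_estimate (x y : UpperHalfPlane)
    (t : ℝ) (ht : dist x y ≤ t)
    (xt : UpperHalfPlane)
    (hre : xt.re = x.re) (him : xt.im = Real.exp t * x.im) :
    |Real.log (y.im / x.im) - (t - dist y xt)| ≤
      (Real.exp (dist x y) - 1) * Real.exp (-t) := by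
  have hx := x.im_pos
  have hy := y.im_pos
  have hT : 0 < Real.exp t := Real.exp_pos t
  have hA : 1 ≤ Real.exp (dist x y) := Real.one_le_exp dist_nonneg
  have hAT : Real.exp (dist x y) ≤ Real.exp t := Real.exp_le_exp.2 ht
  have hcosh := cosh_dist_of_re_eq_of_im_eq_mul (y := y) hT hre him
  have hvA : y.im / x.im ≤ Real.exp (dist x y) := by
    rw [div_le_iff₀ hx, mul_comm, dist_comm]
    exact UpperHalfPlane.im_le_im_mul_exp_dist y x
  have hlower : t - Real.log (y.im / x.im) ≤ dist y xt := by
    have h := (abs_le.1 (UpperHalfPlane.dist_log_im_le y xt)).1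
    rw [him, Real.log_mul hT.ne' hx.ne', Real.log_exp] at h
    rw [Real.log_div hy.ne' hx.ne']
    linarith
  have hcoshA : 2 * Real.cosh (dist x y) =
      Real.exp (dist x y) + (Real.exp (dist x y))⁻¹ := by
    rw [Real.cosh_eq, Real.exp_neg]
    ring
  rw [hcoshA] at hcosh
  rw [Real.exp_neg]
  have hv : 0 < y.im / x.im := div_pos hy hx
  have hlogT : Real.log (Real.exp t) = t := Real.log_exp t
  generalize y.im / x.im = v at *
  generalize Real.exp (dist x y) = A at *
  generalize Real.exp t = T at *
  have hTA : 0 < T + (A - 1) := by linarith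
  have hδ : 0 ≤ (A - 1) * T⁻¹ := mul_nonneg (by linarith) (by positivity)
  have hW : 0 < (T + (A - 1)) / v := div_pos hTA hv
  have hupper : dist y xt ≤ Real.log ((T + (A - 1)) / v) := by
    have hW0 : 0 ≤ Real.log ((T + (A - 1)) / v) := by
      apply Real.log_nonneg
      rw [le_div_iff₀ hv]
      linarith
    rw [← abs_of_nonneg (dist_nonneg (x := y) (y := xt)), ← abs_of_nonneg hW0,
      ← Real.cosh_le_cosh, hcosh, Real.cosh_log hW]
    have hid : ((T + (A - 1)) / v + ((T + (A - 1)) / v)⁻¹) / 2 =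
        ((A - 1) * T + v ^ 2 * (T / (T + (A - 1))) + T ^ 2) / (2 * v * T) := by
      field_simp
      ring
    rw [hid]
    gcongr
    exact mul_add_inv_sub_one_le hA hAT
  have hlog : Real.log ((T + (A - 1)) / v) ≤ t + (A - 1) * T⁻¹ - Real.log v := by
    have hfac : T + (A - 1) = T * (1 + (A - 1) * T⁻¹) := by
      field_simp
    have hpos : 0 < 1 + (A - 1) * T⁻¹ := by linarith
    rw [Real.log_div hTA.ne' hv.ne', hfac, Real.log_mul hT.ne' hpos.ne', hlogT]
    linarith [Real.log_le_sub_one_of_pos hpos]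
  rw [abs_le]
  constructor <;> linarith
end
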